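/- arXiv:1609.00048 — 3 statements merged into one kernel-verified Lean document; each statement's English description precedes it below -/
import Mathlib

section
/- Let F be ℝ or ℂ. Let A ∈ F^{m×n}, let Q ∈ F^{m×k} have orthonormal columns (QᴴQ = I_k), and let P ∈ F^{m×(m−k)} have orthonormal columns with PPᴴ = I_m − QQᴴ. Let Ψ ∈ F^{ℓ×m}, set Ψ₁ := ΨP, Ψ₂ := ΨQ, and W := ΨA. Assume Ψ₂ has full column rank k (equivalently, Ψ₂ᴴΨ₂ is invertible), and define X := (Ψ₂ᴴΨ₂)⁻¹Ψ₂ᴴ W, which equals the Moore–Penrose pseudoinverse of Ψ₂ applied to W. Then X − QᴴA = (Ψ₂ᴴΨ₂)⁻¹Ψ₂ᴴ Ψ₁ (PᴴA). (Lemma A.3.) -/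
open Matrix

/-- **Lemma A.3.**  With `Ψ₁ = Ψ P`, `Ψ₂ = Ψ Q`, `W = Ψ A`, and
`X = (Ψ₂ᴴΨ₂)⁻¹ Ψ₂ᴴ W` (the pseudoinverse of `Ψ₂` applied to `W`, valid since `Ψ₂`
has full column rank), one has `X - Qᴴ A = (Ψ₂ᴴΨ₂)⁻¹ Ψ₂ᴴ Ψ₁ (Pᴴ A)`. -/
theorem second_factor_error {𝕜 : Type*} [RCLike 𝕜] {m n k ℓ : ℕ} (hk : k ≤ m)
    (A : Matrix (Fin m) (Fin n) 𝕜)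
    (Q : Matrix (Fin m) (Fin k) 𝕜) (hQ : Qᴴ * Q = 1)
    (P : Matrix (Fin m) (Fin (m - k)) 𝕜) (hP : Pᴴ * P = 1)
    (hPQ : P * Pᴴ = 1 - Q * Qᴴ)
    (Ψ : Matrix (Fin ℓ) (Fin m) 𝕜)
    (hfull : IsUnit ((Ψ * Q)ᴴ * (Ψ * Q)).det) :
    ((Ψ * Q)ᴴ * (Ψ * Q))⁻¹ * (Ψ * Q)ᴴ * (Ψ * A) - Qᴴ * A
      = ((Ψ * Q)ᴴ * (Ψ * Q))⁻¹ * (Ψ * Q)ᴴ * (Ψ * P) * (Pᴴ * A) := by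
  have hG : ((Ψ * Q)ᴴ * (Ψ * Q))⁻¹ * (Ψ * Q)ᴴ * (Ψ * Q) = 1 := by
    rw [Matrix.mul_assoc, Matrix.nonsing_inv_mul _ hfull]
  generalize ((Ψ * Q)ᴴ * (Ψ * Q))⁻¹ * (Ψ * Q)ᴴ = G at hG ⊢
  calc G * (Ψ * A) - Qᴴ * A = G * (Ψ * A) - G * (Ψ * Q) * (Qᴴ * A) := by
        rw [hG, Matrix.one_mul]
    _ = G * (Ψ * ((1 - Q * Qᴴ) * A)) := by
        simp only [Matrix.sub_mul, Matrix.mul_sub, Matrix.one_mul, Matrix.mul_assoc]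
    _ = G * (Ψ * P) * (Pᴴ * A) := by
        simp only [← hPQ, Matrix.mul_assoc]
end

section
/- Let G ∈ ℝ^{t×s} be a real standard normal random matrix with t > s + 1. Then GᵀG is invertible almost surely, the squared Frobenius norm of the Moore–Penrose pseudoinverse satisfies ‖G†‖_F² = trace((GᵀG)⁻¹) almost surely, and E trace((GᵀG)⁻¹) = s/(t − s − 1). (Fact A.1, equation (A.2), real case.) -/
open Matrix MeasureTheory ProbabilityTheory

/-- Squared Frobenius norm of a real matrix. -/
noncomputable def frobSq {m n : ℕ} (M : Matrix (Fin m) (Fin n) ℝ) : ℝ :=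
  ∑ i, ∑ j, ‖M i j‖ ^ 2

instance matrixMeasurableSpace {t s : ℕ} : MeasurableSpace (Matrix (Fin t) (Fin s) ℝ) :=
  MeasurableSpace.pi

/-- The law of a `t × s` real standard normal matrix: the entries are independent
standard Gaussians. -/
noncomputable def gaussMatrix (t s : ℕ) : Measure (Matrix (Fin t) (Fin s) ℝ) :=
  Measure.pi fun _ : Fin t => Measure.pi fun _ : Fin s => gaussianReal 0 1

/-- Gaussian integration by parts for a bounded function with bounded derivative. -/
theorem integral_id_mul_sub_deriv_gaussianReal {f f' : ℝ → ℝ} {C D : ℝ}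
    (hf : ∀ x, HasDerivAt f (f' x) x) (hC : ∀ x, |f x| ≤ C) (hD : ∀ x, |f' x| ≤ D) :
    ∫ x, (x * f x - f' x) ∂gaussianReal 0 1 = 0 := by
  have hf'eq : f' = deriv f := funext fun x => (hf x).deriv.symm
  have hfm : Measurable f :=
    (continuous_iff_continuousAt.2 fun x => (hf x).continuousAt).measurable
  have hf'm : Measurable f' := hf'eq ▸ measurable_deriv f
  set p : ℝ → ℝ := gaussianPDFReal 0 1 with hp
  have hpd : ∀ x, HasDerivAt p (-x * p x) x := by
    intro x
    have h1 : HasDerivAt (fun x : ℝ => -(x - 0) ^ 2 / (2 * 1)) (-x) x := by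
      have := ((((hasDerivAt_id x).sub_const 0).pow 2).neg).div_const (2 * 1)
      convert! this using 1
      simp [neg_div]
    have h2 := (h1.exp).const_mul ((√(2 * Real.pi * 1))⁻¹)
    convert! h2 using 1
    · simp [hp, gaussianPDFReal_def]
      ring
  have hpi : Integrable p := integrable_gaussianPDFReal 0 1
  have hxp : Integrable (fun x => x * p x) := by
    have h := integrable_mul_exp_neg_mul_sq (b := 1 / 2) (by norm_num)
    refine (h.const_mul (√(2 * Real.pi))⁻¹).congr (.of_forall fun x => ?_)
    simp [hp, gaussianPDFReal_def]
    ring_nf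
  have hfp : Integrable (f * p) := hpi.bdd_mul hfm.aestronglyMeasurable (.of_forall hC)
  have hf'p : Integrable (f' * p) := hpi.bdd_mul hf'm.aestronglyMeasurable (.of_forall hD)
  have hfp' : Integrable (f * fun x => -x * p x) := by
    refine Integrable.bdd_mul ?_ hfm.aestronglyMeasurable (.of_forall hC)
    simpa using hxp.neg
  have key := integral_mul_deriv_eq_deriv_mul_of_integrable (u := f) (v := p)
    (fun x _ => hf x) (fun x _ => hpd x) hfp' hf'p hfp
  rw [integral_gaussianReal_eq_integral_smul one_ne_zero]
  have h3 : ∀ x, gaussianPDFReal 0 1 x • (x * f x - f' x) = -(f x * (-x * p x)) - f' x * p x := by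
    intro x
    simp [hp]
    ring
  simp_rw [h3]
  calc ∫ x, (-(f x * (-x * p x)) - f' x * p x)
      = (∫ x, -(f x * (-x * p x))) - ∫ x, f' x * p x := integral_sub hfp'.neg hf'p
    _ = 0 := by rw [integral_neg, key]; ring

/-- Resampling one coordinate preserves a product of probability measures. -/
theorem measurePreserving_update_pi {ι : Type*} [Fintype ι] [DecidableEq ι] {X : ι → Type*}
    [∀ i, MeasurableSpace (X i)] (μ : ∀ i, Measure (X i)) [∀ i, IsProbabilityMeasure (μ i)]
    (i : ι) :
    MeasurePreserving (fun p : (∀ k, X k) × X i => Function.update p.1 i p.2)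
      ((Measure.pi μ).prod (μ i)) (Measure.pi μ) := by
  have hm : Measurable (fun p : (∀ k, X k) × X i => Function.update p.1 i p.2) := by
    rw [measurable_pi_iff]
    intro k
    by_cases hk : k = i
    · subst hk
      simpa using measurable_snd
    · simp only [Function.update_of_ne hk]
      fun_prop
  refine ⟨hm, (Measure.pi_eq fun S hS => ?_).symm⟩
  rw [Measure.map_apply hm (.univ_pi hS)]
  have : (fun p : (∀ k, X k) × X i => Function.update p.1 i p.2) ⁻¹' Set.univ.pi S =
      (Set.univ.pi (Function.update S i Set.univ)) ×ˢ S i := by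
    ext p
    simp only [Set.mem_preimage, Set.mem_pi, Set.mem_univ, true_implies, Set.mem_prod]
    constructor
    · intro h
      refine ⟨fun k => ?_, by simpa using h i⟩
      by_cases hk : k = i
      · subst hk; simp
      · simpa [hk] using h k
    · rintro ⟨h1, h2⟩ k
      by_cases hk : k = i
      · subst hk; simpa using h2
      · simpa [hk] using h1 k
  rw [this, Measure.prod_prod, Measure.pi_pi,
    ← Finset.mul_prod_erase _ _ (Finset.mem_univ i),
    ← Finset.mul_prod_erase _ (fun k => μ k (S k)) (Finset.mem_univ i)]
  simp only [Function.update_self, measure_univ, one_mul]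
  rw [mul_comm]
  congr 1
  refine Finset.prod_congr rfl fun k hk => ?_
  rw [Function.update_of_ne (Finset.ne_of_mem_erase hk)]

theorem integral_pi_eq_integral_update {ι : Type*} [Fintype ι] [DecidableEq ι] {X : ι → Type*}
    [∀ i, MeasurableSpace (X i)] (μ : ∀ i, Measure (X i)) [∀ i, IsProbabilityMeasure (μ i)]
    (i : ι) {g : (∀ k, X k) → ℝ} (hg : Integrable g (Measure.pi μ)) :
    ∫ ω, g ω ∂Measure.pi μ = ∫ ω, ∫ x, g (Function.update ω i x) ∂μ i ∂Measure.pi μ := by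
  have h := measurePreserving_update_pi μ i
  rw [← h.map_eq, integral_map h.measurable.aemeasurable (by rw [h.map_eq]; exact hg.1),
    integral_prod, h.map_eq]
  exact (h.integrable_comp hg.1).2 hg

theorem ae_integrable_update_pi {ι : Type*} [Fintype ι] [DecidableEq ι] {X : ι → Type*}
    [∀ i, MeasurableSpace (X i)] (μ : ∀ i, Measure (X i)) [∀ i, IsProbabilityMeasure (μ i)]
    (i : ι) {g : (∀ k, X k) → ℝ} (hg : Integrable g (Measure.pi μ)) :
    ∀ᵐ ω ∂Measure.pi μ, Integrable (fun x => g (Function.update ω i x)) (μ i) :=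
  ((measurePreserving_update_pi μ i).integrable_comp hg.1).2 hg |>.prod_right_ae

/-- Gaussian integration by parts in a single matrix entry. -/
theorem integral_entry_mul_sub_gaussMatrix {t s : ℕ} (i : Fin t) (j : Fin s)
    {F D : Matrix (Fin t) (Fin s) ℝ → ℝ} {B C : ℝ}
    (hderiv : ∀ (G : Matrix (Fin t) (Fin s) ℝ) (x : ℝ),
      HasDerivAt (fun y : ℝ => F (G + y • Matrix.single i j (1 : ℝ)))
        (D (G + x • Matrix.single i j (1 : ℝ))) x)
    (hF : ∀ G, |F G| ≤ B) (hD : ∀ G, |D G| ≤ C)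
    (hg_int : Integrable (fun G => G i j * F G - D G) (gaussMatrix t s)) :
    ∫ G, (G i j * F G - D G) ∂gaussMatrix t s = 0 := by
  rw [gaussMatrix] at hg_int ⊢
  refine (integral_pi_eq_integral_update (X := fun _ : Fin t => Fin s → ℝ) _ i hg_int).trans ?_
  refine integral_eq_zero_of_ae ?_
  filter_upwards [ae_integrable_update_pi (X := fun _ : Fin t => Fin s → ℝ) _ i hg_int] with G hG
  rw [integral_pi_eq_integral_update (fun _ : Fin s => gaussianReal 0 1) j hG]
  refine integral_eq_zero_of_ae (.of_forall fun r => ?_)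
  set A : Matrix (Fin t) (Fin s) ℝ := Function.update G i (Function.update r j 0) with hA
  have hupd : ∀ x : ℝ, (Function.update G i (Function.update r j x) : Matrix (Fin t) (Fin s) ℝ) =
      A + x • Matrix.single i j 1 := by
    intro x
    ext k l
    change Function.update G i (Function.update r j x) k l =
      A k l + x * (Matrix.single i j 1 : Matrix (Fin t) (Fin s) ℝ) k l
    rw [Matrix.single_apply]
    by_cases hk : k = i
    · subst hk
      by_cases hl : l = j
      · subst hl; simp [hA]
      · simp [hA, hl, Ne.symm hl]
    · simp [hA, hk, Ne.symm hk]
  have := integral_id_mul_sub_deriv_gaussianReal (hderiv A) (fun x => hF _) (fun x => hD _)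
  refine Eq.trans ?_ this
  refine integral_congr_ae (.of_forall fun x => ?_)
  simp only [Function.update_self]
  exact congrArg (fun M => x * F M - D M) (hupd x)

/-- The regularized inverse Gram matrix `(GᵀG + ε)⁻¹`. -/
noncomputable def ridge {t s : ℕ} (ε : ℝ) (G : Matrix (Fin t) (Fin s) ℝ) :
    Matrix (Fin s) (Fin s) ℝ :=
  (Gᵀ * G + ε • 1)⁻¹

section ridge

variable {t s : ℕ} {ε : ℝ}

theorem posSemidef_gram (G : Matrix (Fin t) (Fin s) ℝ) : (Gᵀ * G).PosSemidef := by
  simpa using Matrix.posSemidef_conjTranspose_mul_self G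

theorem posDef_gram_add (hε : 0 < ε) (G : Matrix (Fin t) (Fin s) ℝ) :
    (Gᵀ * G + ε • (1 : Matrix (Fin s) (Fin s) ℝ)).PosDef :=
  Matrix.PosDef.posSemidef_add (posSemidef_gram G) (Matrix.PosDef.one.smul hε)

theorem posSemidef_ridge (hε : 0 < ε) (G : Matrix (Fin t) (Fin s) ℝ) : (ridge ε G).PosSemidef :=
  (posDef_gram_add hε G).inv.posSemidef

theorem transpose_ridge (G : Matrix (Fin t) (Fin s) ℝ) : (ridge ε G)ᵀ = ridge ε G := by
  simp [ridge, Matrix.transpose_nonsing_inv]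

theorem gram_mul_ridge (hε : 0 < ε) (G : Matrix (Fin t) (Fin s) ℝ) :
    Gᵀ * G * ridge ε G = 1 - ε • ridge ε G := by
  have h := Matrix.mul_nonsing_inv (Gᵀ * G + ε • (1 : Matrix (Fin s) (Fin s) ℝ))
    ((Matrix.isUnit_iff_isUnit_det _).1 (posDef_gram_add hε G).isUnit)
  rw [add_mul, smul_mul_assoc, one_mul] at h
  exact eq_sub_of_add_eq h

theorem trace_gram_mul_ridge (hε : 0 < ε) (G : Matrix (Fin t) (Fin s) ℝ) :
    (Gᵀ * G * ridge ε G).trace = s - ε * (ridge ε G).trace := by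
  simp [gram_mul_ridge hε, Matrix.trace_sub, Matrix.trace_smul]

theorem trace_ridge_mul_gram_mul_ridge (hε : 0 < ε) (G : Matrix (Fin t) (Fin s) ℝ) :
    (ridge ε G * (Gᵀ * G * ridge ε G)).trace =
      (ridge ε G).trace - ε * (ridge ε G * ridge ε G).trace := by
  simp [gram_mul_ridge hε, Matrix.trace_sub, Matrix.trace_smul, mul_sub]

/-- The partial derivative of `(G (GᵀG + ε)⁻¹) i j` with respect to `G i j`. -/
noncomputable def ridgeDeriv (ε : ℝ) (i : Fin t) (j : Fin s) (G : Matrix (Fin t) (Fin s) ℝ) : ℝ :=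
  ridge ε G j j - (G * ridge ε G) i j ^ 2 - (G * ridge ε G * Gᵀ) i i * ridge ε G j j

open scoped Matrix.Norms.Operator in
theorem hasDerivAt_mul_ridge (hε : 0 < ε) (i : Fin t) (j : Fin s) (G : Matrix (Fin t) (Fin s) ℝ)
    (x : ℝ) :
    HasDerivAt (fun y : ℝ => ((G + y • Matrix.single i j (1 : ℝ)) *
        ridge ε (G + y • Matrix.single i j (1 : ℝ))) i j)
      (ridgeDeriv ε i j (G + x • Matrix.single i j (1 : ℝ))) x := by
  set E : Matrix (Fin t) (Fin s) ℝ := Matrix.single i j 1 with hE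
  set H : Matrix (Fin t) (Fin s) ℝ := G + x • E with hH
  set R := ridge ε H with hR
  have hlin : ∀ k l, HasDerivAt (fun y : ℝ => (G + y • E) k l) (E k l) x := by
    intro k l
    simpa using ((hasDerivAt_id x).mul_const (E k l)).const_add (G k l)
  have hgram : HasDerivAt (fun y : ℝ => (G + y • E)ᵀ * (G + y • E) +
      ε • (1 : Matrix (Fin s) (Fin s) ℝ)) (Eᵀ * H + Hᵀ * E) x := by
    refine hasDerivAt_pi.2 fun k => hasDerivAt_pi.2 fun l => ?_
    have := (HasDerivAt.fun_sum (u := Finset.univ)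
      fun m _ => (hlin m k).mul (hlin m l)).add_const ((ε • (1 : Matrix (Fin s) (Fin s) ℝ)) k l)
    convert! this using 1
    simp [Matrix.mul_apply, Finset.sum_add_distrib, hH]
  obtain ⟨u, hu⟩ := (posDef_gram_add hε H).isUnit
  have huR : (↑u⁻¹ : Matrix (Fin s) (Fin s) ℝ) = R := by
    rw [hR, ridge, ← hu, Matrix.coe_units_inv]
  have hinv : HasDerivAt (fun y : ℝ => ridge ε (G + y • E)) (-(R * (Eᵀ * H + Hᵀ * E) * R)) x := by
    have h1 := hasFDerivAt_ringInverse (𝕜 := ℝ) u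
    rw [hu] at h1
    have h2 := h1.comp_hasDerivAt x hgram
    rw [huR] at h2
    convert! h2 using 1
    funext y
    exact Matrix.nonsing_inv_eq_ringInverse _
  have hent : ∀ k, HasDerivAt (fun y : ℝ => ridge ε (G + y • E) k j)
      ((-(R * (Eᵀ * H + Hᵀ * E) * R)) k j) x := fun k =>
    hasDerivAt_pi.1 (hasDerivAt_pi.1 hinv k) j
  have hmain := HasDerivAt.fun_sum (u := Finset.univ) fun k _ => (hlin i k).mul (hent k)
  convert! hmain using 1
  rw [Finset.sum_add_distrib, ← hH, ← hR]
  change _ = (E * R) i j + (H * (-(R * (Eᵀ * H + Hᵀ * E) * R))) i j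
  have hRt : Rᵀ = R := transpose_ridge H
  have e1 : (E * R) i j = R j j := by simp [hE]
  have e2 : (H * R * Eᵀ * (H * R)) i j = (H * R) i j ^ 2 := by
    rw [Matrix.mul_apply, Finset.sum_eq_single i]
    · simp [hE, Matrix.transpose_single, sq]
    · intro b _ hb
      simp [hE, Matrix.transpose_single, hb]
    · simp
  have e3 : (H * R * Hᵀ * (E * R)) i j = (H * R * Hᵀ) i i * R j j := by
    rw [Matrix.mul_apply, Finset.sum_eq_single i]
    · simp [hE]
    · intro b _ hb
      simp [hE, hb]
    · simp
  rw [e1, ridgeDeriv, ← hR, ← e2, ← e3]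
  simp only [Matrix.mul_neg, Matrix.mul_add, Matrix.add_mul, Matrix.neg_apply, Matrix.add_apply,
    Matrix.mul_assoc]
  ring

theorem sum_entry_mul_ridge (G : Matrix (Fin t) (Fin s) ℝ) :
    ∑ i, ∑ j, G i j * (G * ridge ε G) i j = (Gᵀ * G * ridge ε G).trace := by
  rw [Finset.sum_comm, Matrix.mul_assoc]
  simp [Matrix.trace, Matrix.mul_apply (M := Gᵀ)]

theorem sum_sq_mul_ridge (G : Matrix (Fin t) (Fin s) ℝ) :
    ∑ i, ∑ j, (G * ridge ε G) i j ^ 2 = (ridge ε G * (Gᵀ * G * ridge ε G)).trace := by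
  have : ridge ε G * (Gᵀ * G * ridge ε G) = (G * ridge ε G)ᵀ * (G * ridge ε G) := by
    rw [Matrix.transpose_mul, transpose_ridge]
    simp only [Matrix.mul_assoc]
  rw [this, Finset.sum_comm]
  simp only [Matrix.trace, Matrix.diag_apply, Matrix.mul_apply (M := (G * ridge ε G)ᵀ),
    Matrix.transpose_apply, sq]

theorem sum_diag_mul_ridge_mul (G : Matrix (Fin t) (Fin s) ℝ) :
    ∑ i, (G * ridge ε G * Gᵀ) i i = (Gᵀ * G * ridge ε G).trace := by
  change (G * ridge ε G * Gᵀ).trace = _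
  rw [Matrix.trace_mul_comm, Matrix.mul_assoc]

/-- The divergence identity behind the Gaussian integration by parts. -/
theorem sum_entry_mul_sub_ridgeDeriv (hε : 0 < ε) (G : Matrix (Fin t) (Fin s) ℝ) :
    ∑ i, ∑ j, (G i j * (G * ridge ε G) i j - ridgeDeriv ε i j G) =
      s - (((t : ℝ) - s - 1) * (ridge ε G).trace + ε * (ridge ε G * ridge ε G).trace +
        ε * (ridge ε G).trace ^ 2 + ε * (ridge ε G).trace) := by
  have hdiag : ∑ j, ridge ε G j j = (ridge ε G).trace := rfl
  simp only [ridgeDeriv, Finset.sum_sub_distrib, sum_entry_mul_ridge, sum_sq_mul_ridge,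
    ← Finset.mul_sum, ← Finset.sum_mul, sum_diag_mul_ridge_mul, hdiag, trace_gram_mul_ridge hε,
    trace_ridge_mul_gram_mul_ridge hε, Finset.sum_const, Finset.card_univ, Fintype.card_fin,
    nsmul_eq_mul]
  ring

end ridge

/-- Joint diagonalization of a Gram matrix and its regularized inverses, recorded at the level of
traces. -/
theorem exists_eigenvalues_gram {t s : ℕ} (G : Matrix (Fin t) (Fin s) ℝ) :
    ∃ l : Fin s → ℝ, (∀ i, 0 ≤ l i) ∧ (IsUnit (Gᵀ * G).det ↔ ∀ i, l i ≠ 0) ∧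
      ((∀ i, l i ≠ 0) → (Gᵀ * G)⁻¹.trace = ∑ i, (l i)⁻¹) ∧
      ∀ ε, 0 < ε → (ridge ε G).trace = ∑ i, (l i + ε)⁻¹ ∧
        (ridge ε G * ridge ε G).trace = ∑ i, (l i + ε)⁻¹ ^ 2 := by
  have hpsd := posSemidef_gram G
  have hH := hpsd.isHermitian
  set U : Matrix (Fin s) (Fin s) ℝ := (hH.eigenvectorUnitary : Matrix (Fin s) (Fin s) ℝ) with hU
  have hUU : star U * U = 1 := Unitary.coe_star_mul_self hH.eigenvectorUnitary
  have hUU' : U * star U = 1 := Unitary.coe_mul_star_self hH.eigenvectorUnitary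
  have hmul : ∀ a b : Fin s → ℝ, U * diagonal a * star U * (U * diagonal b * star U) =
      U * diagonal (fun i => a i * b i) * star U := by
    intro a b
    rw [← Matrix.diagonal_mul_diagonal]
    calc _ = U * diagonal a * (star U * U) * diagonal b * star U := by simp only [Matrix.mul_assoc]
      _ = _ := by rw [hUU]; simp only [Matrix.mul_assoc, Matrix.one_mul]
  have htr : ∀ a : Fin s → ℝ, (U * diagonal a * star U).trace = ∑ i, a i := by
    intro a
    rw [Matrix.trace_mul_comm, ← Matrix.mul_assoc, hUU, Matrix.one_mul, Matrix.trace_diagonal]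
  have hinv : ∀ a : Fin s → ℝ, (∀ i, a i ≠ 0) → (U * diagonal a * star U)⁻¹ =
      U * diagonal (fun i => (a i)⁻¹) * star U := by
    intro a ha
    refine Matrix.inv_eq_right_inv ?_
    rw [hmul]
    simp [ha, hUU']
  have hspec : Gᵀ * G = U * diagonal hH.eigenvalues * star U := by
    have := hH.spectral_theorem
    rw [Unitary.conjStarAlgAut_apply] at this
    simpa [Function.comp_def] using this
  refine ⟨hH.eigenvalues, hpsd.eigenvalues_nonneg, ?_, fun h0 => ?_, fun ε hε => ?_⟩
  · rw [isUnit_iff_ne_zero, hH.det_eq_prod_eigenvalues]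
    simp [Finset.prod_ne_zero_iff]
  · conv_lhs => rw [hspec]
    rw [hinv _ h0, htr]
  · have hpos : ∀ i, hH.eigenvalues i + ε ≠ 0 := fun i =>
      (add_pos_of_nonneg_of_pos (hpsd.eigenvalues_nonneg i) hε).ne'
    have hridge : ridge ε G = U * diagonal (fun i => (hH.eigenvalues i + ε)⁻¹) * star U := by
      rw [← hinv _ hpos, ridge]
      congr 1
      conv_lhs => rw [hspec]
      rw [← Matrix.diagonal_add, Matrix.mul_add, Matrix.add_mul]
      congr 1
      rw [← Matrix.smul_one_eq_diagonal]
      simp [hUU']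
    rw [hridge, hmul, htr, htr]
    simp [sq]

section bounds

variable {t s : ℕ} {ε : ℝ}

theorem trace_ridge_nonneg (hε : 0 < ε) (G : Matrix (Fin t) (Fin s) ℝ) : 0 ≤ (ridge ε G).trace :=
  (posSemidef_ridge hε G).trace_nonneg

theorem trace_ridge_le (hε : 0 < ε) (G : Matrix (Fin t) (Fin s) ℝ) :
    ε * (ridge ε G).trace ≤ s := by
  obtain ⟨l, hl, -, -, h⟩ := exists_eigenvalues_gram G
  rw [(h ε hε).1, Finset.mul_sum]
  calc ∑ i, ε * (l i + ε)⁻¹ ≤ ∑ _i : Fin s, (1 : ℝ) := by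
        refine Finset.sum_le_sum fun i _ => ?_
        rw [← div_eq_mul_inv, div_le_one (by linarith [hl i])]
        linarith [hl i]
    _ = s := by simp

theorem trace_ridge_sq_nonneg (hε : 0 < ε) (G : Matrix (Fin t) (Fin s) ℝ) :
    0 ≤ (ridge ε G * ridge ε G).trace := by
  obtain ⟨l, hl, -, -, h⟩ := exists_eigenvalues_gram G
  rw [(h ε hε).2]
  positivity

theorem trace_ridge_sq_le (hε : 0 < ε) (G : Matrix (Fin t) (Fin s) ℝ) :
    ε * (ridge ε G * ridge ε G).trace ≤ (ridge ε G).trace := by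
  obtain ⟨l, hl, -, -, h⟩ := exists_eigenvalues_gram G
  rw [(h ε hε).1, (h ε hε).2, Finset.mul_sum]
  refine Finset.sum_le_sum fun i _ => ?_
  have h0 : 0 < l i + ε := by linarith [hl i]
  rw [sq, ← mul_assoc]
  refine mul_le_of_le_one_left (by positivity) ?_
  rw [← div_eq_mul_inv, div_le_one h0]
  linarith [hl i]

theorem inv_le_trace_ridge_of_not_isUnit (hε : 0 < ε) {G : Matrix (Fin t) (Fin s) ℝ}
    (hG : ¬ IsUnit (Gᵀ * G).det) : ε⁻¹ ≤ (ridge ε G).trace := by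
  obtain ⟨l, hl, hu, -, h⟩ := exists_eigenvalues_gram G
  rw [hu] at hG
  push Not at hG
  obtain ⟨i, hi⟩ := hG
  rw [(h ε hε).1]
  refine le_trans (by simp [hi]) (Finset.single_le_sum (f := fun i => (l i + ε)⁻¹)
    (fun k _ => ?_) (Finset.mem_univ i))
  have := hl k
  positivity

theorem trace_ridge_le_trace_inv (hε : 0 < ε) {G : Matrix (Fin t) (Fin s) ℝ}
    (hG : IsUnit (Gᵀ * G).det) : (ridge ε G).trace ≤ (Gᵀ * G)⁻¹.trace := by
  obtain ⟨l, hl, hu, hi, h⟩ := exists_eigenvalues_gram G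
  rw [hu] at hG
  rw [(h ε hε).1, hi hG]
  refine Finset.sum_le_sum fun i _ => inv_anti₀ ((hl i).lt_of_ne' (hG i)) ?_
  linarith

theorem tendsto_trace_ridge {e : ℕ → ℝ} (he : ∀ n, 0 < e n)
    (he0 : Filter.Tendsto e Filter.atTop (nhds 0)) {G : Matrix (Fin t) (Fin s) ℝ}
    (hG : IsUnit (Gᵀ * G).det) :
    Filter.Tendsto (fun n => (ridge (e n) G).trace) Filter.atTop (nhds (Gᵀ * G)⁻¹.trace) := by
  obtain ⟨l, hl, hu, hi, h⟩ := exists_eigenvalues_gram G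
  rw [hu] at hG
  simp only [fun n => (h (e n) (he n)).1, hi hG]
  refine tendsto_finsetSum _ fun i _ => ?_
  have := (he0.const_add (l i)).inv₀ (by simpa using hG i)
  simpa using this

theorem tendsto_trace_ridge_sq {e : ℕ → ℝ} (he : ∀ n, 0 < e n)
    (he0 : Filter.Tendsto e Filter.atTop (nhds 0)) {G : Matrix (Fin t) (Fin s) ℝ}
    (hG : IsUnit (Gᵀ * G).det) :
    Filter.Tendsto (fun n => e n * (ridge (e n) G * ridge (e n) G).trace) Filter.atTop
      (nhds 0) := by
  obtain ⟨l, hl, hu, hi, h⟩ := exists_eigenvalues_gram G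
  rw [hu] at hG
  simp only [fun n => (h (e n) (he n)).2]
  rw [← zero_mul (∑ i, (l i)⁻¹ ^ 2)]
  refine he0.mul (tendsto_finsetSum _ fun i _ => ?_)
  have := ((he0.const_add (l i)).inv₀ (by simpa using hG i)).pow 2
  simpa using this

theorem ridge_diag_le (hε : 0 < ε) (G : Matrix (Fin t) (Fin s) ℝ) (j : Fin s) :
    ridge ε G j j ≤ s / ε := by
  rw [le_div_iff₀' hε]
  refine le_trans (mul_le_mul_of_nonneg_left ?_ hε.le) (trace_ridge_le hε G)
  exact Finset.single_le_sum (f := fun k => ridge ε G k k)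
    (fun k _ => (posSemidef_ridge hε G).diag_nonneg) (Finset.mem_univ j)

theorem mul_ridge_sq_le (hε : 0 < ε) (G : Matrix (Fin t) (Fin s) ℝ) (i : Fin t) (j : Fin s) :
    (G * ridge ε G) i j ^ 2 ≤ s / ε := by
  calc (G * ridge ε G) i j ^ 2 ≤ ∑ l, (G * ridge ε G) i l ^ 2 :=
        Finset.single_le_sum (f := fun l => (G * ridge ε G) i l ^ 2)
          (fun _ _ => sq_nonneg _) (Finset.mem_univ j)
    _ ≤ ∑ k, ∑ l, (G * ridge ε G) k l ^ 2 :=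
        Finset.single_le_sum (f := fun k => ∑ l, (G * ridge ε G) k l ^ 2)
          (fun _ _ => Finset.sum_nonneg fun _ _ => sq_nonneg _) (Finset.mem_univ i)
    _ ≤ s / ε := by
        rw [sum_sq_mul_ridge, trace_ridge_mul_gram_mul_ridge hε, le_div_iff₀' hε]
        refine le_trans (mul_le_mul_of_nonneg_left ?_ hε.le) (trace_ridge_le hε G)
        linarith [mul_nonneg hε.le (trace_ridge_sq_nonneg hε G)]

theorem abs_mul_ridge_le (hε : 0 < ε) (i : Fin t) (j : Fin s) (G : Matrix (Fin t) (Fin s) ℝ) :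
    |(G * ridge ε G) i j| ≤ √(s / ε) :=
  Real.abs_le_sqrt (mul_ridge_sq_le hε G i j)

theorem abs_ridgeDeriv_le (hε : 0 < ε) (i : Fin t) (j : Fin s) (G : Matrix (Fin t) (Fin s) ℝ) :
    |ridgeDeriv ε i j G| ≤ s / ε + s / ε + s * (s / ε) := by
  have hpsd : (G * ridge ε G * Gᵀ).PosSemidef := by
    simpa using (posSemidef_ridge hε G).mul_mul_conjTranspose_same G
  have h1 : 0 ≤ ridge ε G j j := (posSemidef_ridge hε G).diag_nonneg
  have h2 := ridge_diag_le hε G j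
  have h3 := mul_ridge_sq_le hε G i j
  have h4 : 0 ≤ (G * ridge ε G * Gᵀ) i i := hpsd.diag_nonneg
  have h5 : (G * ridge ε G * Gᵀ) i i ≤ s :=
    calc (G * ridge ε G * Gᵀ) i i ≤ ∑ k, (G * ridge ε G * Gᵀ) k k :=
          Finset.single_le_sum (f := fun k => (G * ridge ε G * Gᵀ) k k)
            (fun k _ => hpsd.diag_nonneg) (Finset.mem_univ i)
      _ ≤ s := by
          rw [sum_diag_mul_ridge_mul, trace_gram_mul_ridge hε]
          linarith [mul_nonneg hε.le (trace_ridge_nonneg hε G)]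
  have h6 := mul_le_mul h5 h2 h1 (by positivity)
  have h7 := mul_nonneg h4 h1
  have h8 := sq_nonneg ((G * ridge ε G) i j)
  rw [ridgeDeriv, abs_le]
  constructor <;> linarith

theorem measurable_inv_entry (A : Matrix (Fin t) (Fin s) ℝ → Matrix (Fin s) (Fin s) ℝ)
    (hA : ∀ k l, Measurable fun G => A G k l) (k l : Fin s) :
    Measurable fun G => (A G)⁻¹ k l := by
  have hdet : ∀ B : Matrix (Fin t) (Fin s) ℝ → Matrix (Fin s) (Fin s) ℝ,
      (∀ k l, Measurable fun G => B G k l) → Measurable fun G => (B G).det := by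
    intro B hB
    simp only [Matrix.det_apply]
    fun_prop
  simp only [Matrix.inv_def, Matrix.smul_apply, Ring.inverse_eq_inv', smul_eq_mul,
    Matrix.adjugate_apply]
  refine (hdet A hA).inv.mul (hdet _ fun a b => ?_)
  by_cases h : a = l
  · subst h; simp
  · simpa [Matrix.updateRow_ne h] using hA a b

theorem measurable_entry (i : Fin t) (j : Fin s) :
    Measurable fun G : Matrix (Fin t) (Fin s) ℝ => G i j :=
  (measurable_pi_apply j).comp (measurable_pi_apply i)

theorem measurable_gram_entry (k l : Fin s) :
    Measurable fun G : Matrix (Fin t) (Fin s) ℝ => (Gᵀ * G) k l := by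
  simp only [Matrix.mul_apply, Matrix.transpose_apply]
  exact Finset.measurable_fun_sum _ fun i _ => (measurable_entry i k).mul (measurable_entry i l)

theorem measurable_ridge_entry (ε : ℝ) (k l : Fin s) :
    Measurable fun G : Matrix (Fin t) (Fin s) ℝ => ridge ε G k l := by
  refine measurable_inv_entry _ (fun k l => ?_) k l
  simp only [Matrix.add_apply]
  exact (measurable_gram_entry k l).add_const _

theorem measurable_trace_inv_gram :
    Measurable fun G : Matrix (Fin t) (Fin s) ℝ => (Gᵀ * G)⁻¹.trace :=
  Finset.measurable_fun_sum _ fun i _ => measurable_inv_entry _ measurable_gram_entry i i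

theorem measurable_trace_ridge (ε : ℝ) :
    Measurable fun G : Matrix (Fin t) (Fin s) ℝ => (ridge ε G).trace :=
  Finset.measurable_fun_sum _ fun i _ => measurable_ridge_entry ε i i

theorem measurable_trace_ridge_sq (ε : ℝ) :
    Measurable fun G : Matrix (Fin t) (Fin s) ℝ => (ridge ε G * ridge ε G).trace := by
  refine Finset.measurable_fun_sum _ fun i _ => ?_
  simp only [Matrix.diag_apply, Matrix.mul_apply]
  exact Finset.measurable_fun_sum _ fun k _ =>
    (measurable_ridge_entry ε i k).mul (measurable_ridge_entry ε k i)

theorem measurable_mul_ridge_entry (ε : ℝ) (i : Fin t) (j : Fin s) :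
    Measurable fun G : Matrix (Fin t) (Fin s) ℝ => (G * ridge ε G) i j := by
  simp only [Matrix.mul_apply]
  exact Finset.measurable_fun_sum _ fun k _ =>
    (measurable_entry i k).mul (measurable_ridge_entry ε k j)

theorem measurable_ridgeDeriv (ε : ℝ) (i : Fin t) (j : Fin s) :
    Measurable fun G : Matrix (Fin t) (Fin s) ℝ => ridgeDeriv ε i j G := by
  unfold ridgeDeriv
  refine ((measurable_ridge_entry ε j j).sub ((measurable_mul_ridge_entry ε i j).pow_const 2)).sub
    (Measurable.mul ?_ (measurable_ridge_entry ε j j))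
  simp only [Matrix.mul_apply (N := _ᵀ), Matrix.transpose_apply]
  exact Finset.measurable_fun_sum _ fun k _ =>
    (measurable_mul_ridge_entry ε i k).mul (measurable_entry i k)

instance isProbabilityMeasure_gaussMatrix : IsProbabilityMeasure (gaussMatrix t s) :=
  inferInstanceAs (IsProbabilityMeasure
    (Measure.pi fun _ : Fin t => Measure.pi fun _ : Fin s => gaussianReal 0 1))

theorem integrable_entry_gaussMatrix (i : Fin t) (j : Fin s) :
    Integrable (fun G => G i j) (gaussMatrix t s) := by
  have h1 : Integrable (fun x : ℝ => x) (gaussianReal 0 1) :=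
    (memLp_id_gaussianReal' 1 (by simp)).integrable le_rfl
  have h2 : Integrable (fun r : Fin s → ℝ => r j) (Measure.pi fun _ => gaussianReal 0 1) :=
    (measurePreserving_eval (fun _ : Fin s => gaussianReal 0 1) j).integrable_comp_of_integrable h1
  exact (measurePreserving_eval (fun _ : Fin t => Measure.pi fun _ : Fin s => gaussianReal 0 1)
    i).integrable_comp_of_integrable h2

/-- The regularized moment identity. -/
theorem integral_trace_ridge (hε : 0 < ε) :
    ∫ G, (((t : ℝ) - s - 1) * (ridge ε G).trace + ε * (ridge ε G * ridge ε G).trace +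
        ε * (ridge ε G).trace ^ 2 + ε * (ridge ε G).trace) ∂gaussMatrix t s = (s : ℝ) := by
  have hg_int : ∀ i j, Integrable (fun G => G i j * (G * ridge ε G) i j - ridgeDeriv ε i j G)
      (gaussMatrix t s) := fun i j =>
    ((integrable_entry_gaussMatrix i j).mul_bdd
      (measurable_mul_ridge_entry ε i j).aestronglyMeasurable
      (.of_forall (abs_mul_ridge_le hε i j))).sub
    (.of_bound (measurable_ridgeDeriv ε i j).aestronglyMeasurable _
      (.of_forall (abs_ridgeDeriv_le hε i j)))
  have hzero : ∫ G, ∑ i, ∑ j, (G i j * (G * ridge ε G) i j - ridgeDeriv ε i j G)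
      ∂gaussMatrix t s = 0 := by
    rw [integral_finsetSum _ fun i _ => integrable_finsetSum _ fun j _ => hg_int i j]
    refine Finset.sum_eq_zero fun i _ => ?_
    rw [integral_finsetSum _ fun j _ => hg_int i j]
    exact Finset.sum_eq_zero fun j _ => integral_entry_mul_sub_gaussMatrix i j
      (fun G x => hasDerivAt_mul_ridge hε i j G x) (abs_mul_ridge_le hε i j)
      (abs_ridgeDeriv_le hε i j) (hg_int i j)
  have hsum : Integrable (fun G => ∑ i, ∑ j, (G i j * (G * ridge ε G) i j - ridgeDeriv ε i j G))
      (gaussMatrix t s) :=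
    integrable_finsetSum _ fun i _ => integrable_finsetSum _ fun j _ => hg_int i j
  calc _ = ∫ G, ((s : ℝ) - ∑ i, ∑ j, (G i j * (G * ridge ε G) i j - ridgeDeriv ε i j G))
        ∂gaussMatrix t s := by
        refine integral_congr_ae (.of_forall fun G => ?_)
        simp only [sum_entry_mul_sub_ridgeDeriv hε]
        ring
    _ = s := by
        rw [integral_sub (integrable_const _) hsum, hzero]
        simp

theorem integrable_trace_ridge (hε : 0 < ε) :
    Integrable (fun G => (ridge ε G).trace) (gaussMatrix t s) :=
  .of_bound (measurable_trace_ridge ε).aestronglyMeasurable (s / ε) (.of_forall fun G => by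
    rw [Real.norm_of_nonneg (trace_ridge_nonneg hε G), le_div_iff₀' hε]
    exact trace_ridge_le hε G)

theorem integrable_trace_ridge_terms (hε : 0 < ε) (c : ℝ) :
    Integrable (fun G => c * (ridge ε G).trace + ε * (ridge ε G * ridge ε G).trace +
        ε * (ridge ε G).trace ^ 2 + ε * (ridge ε G).trace) (gaussMatrix t s) := by
  have h1 := integrable_trace_ridge (t := t) (s := s) hε
  have h2 : Integrable (fun G => ε * (ridge ε G * ridge ε G).trace) (gaussMatrix t s) :=
    h1.mono' ((measurable_trace_ridge_sq ε).const_mul ε).aestronglyMeasurable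
      (.of_forall fun G => by
        rw [Real.norm_of_nonneg (mul_nonneg hε.le (trace_ridge_sq_nonneg hε G))]
        exact trace_ridge_sq_le hε G)
  have h3 : Integrable (fun G => ε * (ridge ε G).trace ^ 2) (gaussMatrix t s) :=
    (h1.const_mul s).mono'
      (((measurable_trace_ridge ε).pow_const 2).const_mul ε).aestronglyMeasurable
      (.of_forall fun G => by
        rw [Real.norm_of_nonneg (mul_nonneg hε.le (sq_nonneg _)), sq, ← mul_assoc]
        exact mul_le_mul_of_nonneg_right (trace_ridge_le hε G) (trace_ridge_nonneg hε G))
  exact (((h1.const_mul c).add h2).add h3).add (h1.const_mul ε)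

theorem integral_trace_ridge_le (h : s + 1 < t) (hε : 0 < ε) :
    ∫ G, (ridge ε G).trace ∂gaussMatrix t s ≤ s / ((t : ℝ) - s - 1) := by
  have hpos : (0 : ℝ) < (t : ℝ) - s - 1 := by
    have : ((s + 1 : ℕ) : ℝ) < t := by exact_mod_cast h
    push_cast at this
    linarith
  rw [le_div_iff₀' hpos, ← integral_const_mul]
  refine le_of_le_of_eq ?_ (integral_trace_ridge (t := t) hε)
  refine integral_mono ((integrable_trace_ridge hε).const_mul _)
    (integrable_trace_ridge_terms hε _) fun G => ?_
  have h1 := trace_ridge_nonneg hε G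
  have h2 := trace_ridge_sq_nonneg hε G
  have : 0 ≤ ε * (ridge ε G * ridge ε G).trace + ε * (ridge ε G).trace ^ 2 +
    ε * (ridge ε G).trace := by positivity
  simp only
  linarith

theorem ae_isUnit_det_gram (h : s + 1 < t) :
    ∀ᵐ G ∂gaussMatrix t s, IsUnit (Gᵀ * G).det := by
  set C : ℝ := s / ((t : ℝ) - s - 1)
  have hle : ∀ ε : ℝ, 0 < ε → (gaussMatrix t s).real {G | ¬ IsUnit (Gᵀ * G).det} ≤ C * ε := by
    intro ε hε
    have h1 := mul_meas_ge_le_integral_of_nonneg (μ := gaussMatrix t s)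
      (.of_forall fun G => trace_ridge_nonneg hε G) (integrable_trace_ridge hε) ε⁻¹
    have h2 : (gaussMatrix t s).real {G | ¬ IsUnit (Gᵀ * G).det} ≤
        (gaussMatrix t s).real {G | ε⁻¹ ≤ (ridge ε G).trace} :=
      measureReal_mono fun G hG => inv_le_trace_ridge_of_not_isUnit hε hG
    have h3 := h1.trans (integral_trace_ridge_le h hε)
    rw [inv_mul_le_iff₀' hε] at h3
    exact h2.trans h3
  have h0 : (gaussMatrix t s).real {G | ¬ IsUnit (Gᵀ * G).det} ≤ 0 := by
    have hlim : Filter.Tendsto (fun ε : ℝ => C * ε) (nhdsWithin 0 (Set.Ioi 0)) (nhds 0) := by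
      have : Filter.Tendsto (fun ε : ℝ => C * ε) (nhds 0) (nhds (C * 0)) :=
        (continuous_const_mul C).tendsto 0
      rw [mul_zero] at this
      exact this.mono_left nhdsWithin_le_nhds
    exact ge_of_tendsto hlim (Filter.eventually_of_mem self_mem_nhdsWithin hle)
  rw [ae_iff, ← measureReal_eq_zero_iff]
  exact le_antisymm h0 measureReal_nonneg

theorem integrable_trace_inv_gram (h : s + 1 < t) :
    Integrable (fun G => (Gᵀ * G)⁻¹.trace) (gaussMatrix t s) := by
  set e : ℕ → ℝ := fun n => 1 / ((n : ℝ) + 1)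
  have he : ∀ n : ℕ, 0 < e n := fun n => by positivity
  have he0 : Filter.Tendsto e Filter.atTop (nhds 0) := tendsto_one_div_add_atTop_nhds_zero_nat
  refine ⟨measurable_trace_inv_gram.aestronglyMeasurable, ?_⟩
  set C : ℝ := s / ((t : ℝ) - s - 1)
  have hbound : ∀ n, ∫⁻ G, ‖(ridge (e n) G).trace‖ₑ ∂gaussMatrix t s ≤ ENNReal.ofReal C := by
    intro n
    have h1 := ofReal_integral_norm_eq_lintegral_enorm
      (integrable_trace_ridge (t := t) (s := s) (he n))
    rw [← h1]
    refine ENNReal.ofReal_le_ofReal (le_trans (le_of_eq ?_) (integral_trace_ridge_le h (he n)))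
    exact integral_congr_ae (.of_forall fun G =>
      Real.norm_of_nonneg (trace_ridge_nonneg (he n) G))
  calc ∫⁻ G, ‖(Gᵀ * G)⁻¹.trace‖ₑ ∂gaussMatrix t s
      = ∫⁻ G, Filter.liminf (fun n => ‖(ridge (e n) G).trace‖ₑ) Filter.atTop ∂gaussMatrix t s := by
        refine lintegral_congr_ae ?_
        filter_upwards [ae_isUnit_det_gram h] with G hG
        exact (tendsto_trace_ridge he he0 hG).enorm.liminf_eq.symm
    _ ≤ Filter.liminf (fun n => ∫⁻ G, ‖(ridge (e n) G).trace‖ₑ ∂gaussMatrix t s) Filter.atTop :=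
        lintegral_liminf_le fun n => (measurable_trace_ridge (e n)).enorm
    _ ≤ ENNReal.ofReal C :=
        Filter.liminf_le_of_le (by isBoundedDefault) fun b hb => by
          obtain ⟨n, hn⟩ := hb.exists
          exact hn.trans (hbound n)
    _ < ⊤ := ENNReal.ofReal_lt_top

theorem integral_trace_inv_gram (h : s + 1 < t) :
    ∫ G, (Gᵀ * G)⁻¹.trace ∂gaussMatrix t s = (s : ℝ) / ((t : ℝ) - s - 1) := by
  set e : ℕ → ℝ := fun n => 1 / ((n : ℝ) + 1)
  have he : ∀ n : ℕ, 0 < e n := fun n => by positivity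
  have he1 : ∀ n : ℕ, e n ≤ 1 := fun n => by
    rw [div_le_one (by positivity)]
    linarith [(Nat.cast_nonneg n : (0 : ℝ) ≤ n)]
  have he0 : Filter.Tendsto e Filter.atTop (nhds 0) := tendsto_one_div_add_atTop_nhds_zero_nat
  have hpos : (0 : ℝ) < (t : ℝ) - s - 1 := by
    have : ((s + 1 : ℕ) : ℝ) < t := by exact_mod_cast h
    push_cast at this
    linarith
  have hT := integrable_trace_inv_gram h
  have hlim := tendsto_integral_of_dominated_convergence (μ := gaussMatrix t s)
    (F := fun n G => ((t : ℝ) - s - 1) * (ridge (e n) G).trace +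
      e n * (ridge (e n) G * ridge (e n) G).trace + e n * (ridge (e n) G).trace ^ 2 +
      e n * (ridge (e n) G).trace)
    (f := fun G => ((t : ℝ) - s - 1) * (Gᵀ * G)⁻¹.trace)
    (fun G => (((t : ℝ) - s - 1) + 1 + s + 1) * (Gᵀ * G)⁻¹.trace)
    (fun n => (integrable_trace_ridge_terms (he n) _).1) (hT.const_mul _) ?_ ?_
  · simp only [fun n => integral_trace_ridge (t := t) (s := s) (he n)] at hlim
    rw [integral_const_mul] at hlim
    rw [eq_div_iff hpos.ne', mul_comm]
    exact (tendsto_nhds_unique hlim tendsto_const_nhds)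
  · intro n
    filter_upwards [ae_isUnit_det_gram h] with G hG
    have h1 := trace_ridge_nonneg (he n) G
    have h2 := trace_ridge_sq_nonneg (he n) G
    have h3 := trace_ridge_le_trace_inv (he n) hG
    have h4 := trace_ridge_sq_le (he n) G
    have h5 := mul_le_mul_of_nonneg_right (trace_ridge_le (he n) G) h1
    have h6 := mul_le_mul_of_nonneg_left h3 (Nat.cast_nonneg (α := ℝ) s)
    have h7 := mul_le_mul_of_nonneg_left h3 hpos.le
    have h8 := mul_le_mul_of_nonneg_right (he1 n) h1
    have h9 := (he n).le
    rw [Real.norm_of_nonneg (by positivity)]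
    nlinarith
  · filter_upwards [ae_isUnit_det_gram h] with G hG
    have h1 := tendsto_trace_ridge he he0 hG
    have h2 := tendsto_trace_ridge_sq he he0 hG
    simpa using (((h1.const_mul ((t : ℝ) - s - 1)).add h2).add (he0.mul (h1.pow 2))).add
      (he0.mul h1)

theorem frobSq_eq_trace {m n : ℕ} (M : Matrix (Fin m) (Fin n) ℝ) : frobSq M = (M * Mᵀ).trace := by
  simp [frobSq, Matrix.trace, Matrix.mul_apply, sq]

theorem frobSq_pinv_of_isUnit {G : Matrix (Fin t) (Fin s) ℝ} (hG : IsUnit (Gᵀ * G).det) :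
    frobSq ((Gᵀ * G)⁻¹ * Gᵀ) = ((Gᵀ * G)⁻¹).trace := by
  rw [frobSq_eq_trace, Matrix.transpose_mul, Matrix.transpose_transpose,
    Matrix.transpose_nonsing_inv, Matrix.transpose_mul, Matrix.transpose_transpose,
    Matrix.mul_assoc, ← Matrix.mul_assoc Gᵀ, Matrix.mul_nonsing_inv _ hG, Matrix.mul_one]

end bounds

/-- **Fact A.1, equation (A.2), real case.**  For a real standard normal `t × s` matrix `G`
with `t > s + 1`: `GᵀG` is invertible a.s., `‖G†‖_F² = trace((GᵀG)⁻¹)` a.s. (where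
`G† = (GᵀG)⁻¹Gᵀ` is the Moore–Penrose pseudoinverse), and
`E trace((GᵀG)⁻¹) = s / (t - s - 1)`. -/
theorem expect_trace_inv_gram_gauss {t s : ℕ} (h : s + 1 < t) :
    (∀ᵐ G ∂(gaussMatrix t s), IsUnit (Gᵀ * G).det) ∧
    (∀ᵐ G ∂(gaussMatrix t s), frobSq ((Gᵀ * G)⁻¹ * Gᵀ) = ((Gᵀ * G)⁻¹).trace) ∧
    ∫ G, ((Gᵀ * G)⁻¹).trace ∂(gaussMatrix t s) = (s : ℝ) / ((t : ℝ) - s - 1) := by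
  refine ⟨ae_isUnit_det_gram h, ?_, integral_trace_inv_gram h⟩
  filter_upwards [ae_isUnit_det_gram h] with G hG using frobSq_pinv_of_isUnit hG
end

section
/- Fix A ∈ ℝ^{m×n} and a matrix Q ∈ ℝ^{m×k} with orthonormal columns (QᵀQ = I_k), where ℓ > k + 1 and ℓ ≤ m. Let Ψ ∈ ℝ^{ℓ×m} be a real standard normal random matrix, and define (almost surely) X := ((ΨQ)ᵀ(ΨQ))⁻¹(ΨQ)ᵀ Ψ A, i.e., X = (ΨQ)† Ψ A. Then X is an unbiased estimator of QᵀA: E[X − QᵀA] = 0 entrywise. (Lemma A.4, first part.) -/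
open Matrix MeasureTheory ProbabilityTheory

/-- A finite product of σ-finite measures is monotone for absolute continuity. -/
theorem pi_absolutelyContinuous_pi {α : Type*} [MeasurableSpace α] {n : ℕ}
    {μ ν : Fin n → Measure α} [∀ i, SigmaFinite (μ i)] [∀ i, SigmaFinite (ν i)]
    (h : ∀ i, μ i ≪ ν i) : Measure.pi μ ≪ Measure.pi ν := by
  induction n with
  | zero => rw [Measure.pi_of_empty μ, Measure.pi_of_empty ν]
  | succ n ih =>
    rw [← (measurePreserving_piFinSuccAbove μ 0).symm.map_eq,
      ← (measurePreserving_piFinSuccAbove ν 0).symm.map_eq]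
    exact ((h 0).prod (ih fun j => h _)).map (MeasurableEquiv.measurable _)

/-- A right-invariant measure vanishes on a measurable set which meets every line of a fixed
direction in a countable set. -/
theorem measure_eq_zero_of_countable_line {E : Type*} [AddCommGroup E] [Module ℝ E]
    [MeasurableSpace E] [MeasurableAdd₂ E] [MeasurableSMul ℝ E]
    (μ : Measure E) [SigmaFinite μ] [μ.IsAddRightInvariant] {s : Set E} (hs : MeasurableSet s)
    (b : E) (h : ∀ x, {t : ℝ | x + t • b ∈ s}.Countable) : μ s = 0 := by
  have hm : Measurable fun p : E × ℝ => p.1 + p.2 • b := by fun_prop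
  have hprod : (μ.prod volume) ((fun p : E × ℝ => p.1 + p.2 • b) ⁻¹' s) = 0 := by
    rw [Measure.measure_prod_null (hm hs)]
    exact .of_forall fun x => (h x).measure_zero volume
  have hswap := Measure.measure_prod_null (hm.comp measurable_swap hs) |>.mp <|
    (Measure.measurePreserving_swap (μ := (volume : Measure ℝ)) (ν := μ)).measure_preimage
      (hm hs).nullMeasurableSet |>.trans hprod
  obtain ⟨t, ht⟩ := hswap.exists
  rw [← measure_preimage_add_right μ (t • b) s]
  exact ht

/-- The standard Gaussian measure on row vectors is invariant under orthogonal matrices. -/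
theorem measurePreserving_vecMul_gaussian {m : ℕ} (R : Matrix (Fin m) (Fin m) ℝ)
    (hR : R * Rᵀ = 1) :
    MeasurePreserving (fun v : Fin m → ℝ => v ᵥ* R)
      (Measure.pi fun _ => gaussianReal 0 1) (Measure.pi fun _ => gaussianReal 0 1) := by
  have hmeas : Measurable fun v : Fin m → ℝ => v ᵥ* R :=
    (Continuous.matrix_vecMul continuous_id continuous_const).measurable
  refine ⟨hmeas, ?_⟩
  have hon : Orthonormal ℝ fun i => WithLp.toLp 2 (R i) := by
    rw [orthonormal_iff_ite]
    intro i j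
    have := congrFun (congrFun hR j) i
    simp only [Matrix.mul_apply', Matrix.one_apply] at this
    simpa [EuclideanSpace.inner_eq_star_dotProduct, eq_comm] using! this
  let b := OrthonormalBasis.mk hon
    (hon.linearIndependent.span_eq_top_of_card_eq_finrank' (by simp)).ge
  have hb : ∀ i, b i = WithLp.toLp 2 (R i) := fun i => by simp [b]
  have hcomp : (fun x : Fin m → ℝ => ∑ i, x i • b i) = WithLp.toLp 2 ∘ fun v => v ᵥ* R := by
    ext x j
    simp [hb, Matrix.vecMul, dotProduct]
  have key := stdGaussian_eq_map_pi_orthonormalBasis b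
  rw [← map_pi_eq_stdGaussian, hcomp,
    ← Measure.map_map (WithLp.measurable_toLp 2 _) hmeas] at key
  exact ((MeasurableEquiv.toLp 2 (Fin m → ℝ)).map_measurableEquiv_injective key).symm

theorem measurePreserving_mul_gaussMatrix {t s : ℕ} (R : Matrix (Fin s) (Fin s) ℝ)
    (hR : R * Rᵀ = 1) :
    MeasurePreserving (fun M : Matrix (Fin t) (Fin s) ℝ => M * R)
      (gaussMatrix t s) (gaussMatrix t s) :=
  measurePreserving_pi _ _ fun _ : Fin t => measurePreserving_vecMul_gaussian R hR

theorem gaussMatrix_absolutelyContinuous (t s : ℕ) :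
    gaussMatrix t s ≪ (volume : Measure (Fin t → Fin s → ℝ)) :=
  pi_absolutelyContinuous_pi fun _ => pi_absolutelyContinuous_pi fun _ =>
    gaussianReal_absolutelyContinuous 0 one_ne_zero

/-- Only finitely many scalar shifts of a square matrix are singular. -/
theorem finite_det_add_smul_one_eq_zero {k : ℕ} (M : Matrix (Fin k) (Fin k) ℝ) :
    {t : ℝ | (M + t • 1).det = 0}.Finite := by
  refine ((-M).charpoly.roots.toFinset.finite_toSet).subset fun t ht => ?_
  have : (-M).charpoly.eval t = 0 := by
    rw [Matrix.eval_charpoly, sub_neg_eq_add, add_comm, Matrix.scalar_apply,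
      ← Matrix.smul_one_eq_diagonal]
    exact ht
  simpa [(charpoly_monic (-M)).ne_zero] using this

/-- If `Q` has a left inverse, the sketch `Ψ * Q` almost surely has an invertible Gram matrix. -/
theorem ae_isUnit_det_gram_s5 {m k ℓ : ℕ} (hℓ : k ≤ ℓ) (Q : Matrix (Fin m) (Fin k) ℝ)
    (P : Matrix (Fin k) (Fin m) ℝ) (hPQ : P * Q = 1) :
    ∀ᵐ Ψ ∂(gaussMatrix ℓ m), IsUnit ((Ψ * Q)ᵀ * (Ψ * Q)).det := by
  let r : Fin k → Fin ℓ := Fin.castLE hℓ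
  let B : Fin ℓ → Fin m → ℝ := fun i => if h : i.val < k then P ⟨i, h⟩ else 0
  let minor : (Fin ℓ → Fin m → ℝ) → Matrix (Fin k) (Fin k) ℝ := fun Ψ =>
    Matrix.of (fun i => Ψ (r i)) * Q
  have hB : minor B = 1 := by
    rw [← hPQ]
    simp only [minor]
    congr 1
    ext i j
    simp [B, r]
  have hminor : ∀ Ψ (t : ℝ), minor (Ψ + t • B) = minor Ψ + t • 1 := fun Ψ t => by
    rw [← hB]
    simp only [minor]
    rw [← Matrix.smul_mul, ← Matrix.add_mul]
    rfl
  have hcont : Continuous fun Ψ => (minor Ψ).det := by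
    refine Continuous.matrix_det (Continuous.matrix_mul ?_ continuous_const)
    exact continuous_matrix fun i j => by simpa using! continuous_apply_apply (r i) j
  have hnull : (volume : Measure (Fin ℓ → Fin m → ℝ)) {Ψ | (minor Ψ).det = 0} = 0 := by
    refine measure_eq_zero_of_countable_line volume
      (isClosed_singleton.preimage hcont).measurableSet B fun Ψ => ?_
    simp only [Set.mem_ofPred_eq, hminor]
    exact (finite_det_add_smul_one_eq_zero _).countable
  have hvol : ∀ᵐ Ψ : Fin ℓ → Fin m → ℝ, (minor Ψ).det ≠ 0 := by
    rw [ae_iff]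
    simpa using hnull
  have hae : ∀ᵐ Ψ ∂(gaussMatrix ℓ m), (minor Ψ).det ≠ 0 :=
    (gaussMatrix_absolutelyContinuous ℓ m).ae_le hvol
  filter_upwards [hae] with Ψ hΨ
  rw [← Matrix.isUnit_iff_isUnit_det, ← Matrix.conjTranspose_eq_transpose_of_trivial]
  refine (Matrix.PosDef.conjTranspose_mul_self (Ψ * Q) ?_).isUnit
  intro v w hvw
  refine Matrix.mulVec_injective_of_isUnit
    ((Matrix.isUnit_iff_isUnit_det _).mpr hΨ.isUnit) ?_
  ext i
  exact congrFun hvw (r i)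

/-- An almost everywhere odd function under a measure-preserving equivalence has integral zero. -/
theorem integral_eq_zero_of_ae_comp_eq_neg {α : Type*} [MeasurableSpace α] {μ : Measure α}
    (e : α ≃ᵐ α) (he : MeasurePreserving e μ μ) {f : α → ℝ}
    (hf : ∀ᵐ x ∂μ, f (e x) = -f x) : ∫ x, f x ∂μ = 0 := by
  have h : ∫ x, f x ∂μ = -∫ x, f x ∂μ := by
    rw [← integral_neg, ← integral_congr_ae hf]
    exact (he.integral_comp' f).symm
  linarith

/-- **Lemma A.4, first part.**  For a fixed `A ∈ ℝ^{m×n}` and `Q ∈ ℝ^{m×k}` with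
orthonormal columns, and `Ψ ∈ ℝ^{ℓ×m}` standard normal with `ℓ > k + 1`, the matrix
`X = (ΨQ)† Ψ A = ((ΨQ)ᵀ(ΨQ))⁻¹ (ΨQ)ᵀ Ψ A` is an unbiased estimator of `Qᵀ A`:
`E[X - QᵀA] = 0` entrywise. -/
theorem unbiased_second_factor {m n k ℓ : ℕ} (hℓ : k + 1 < ℓ) (hℓm : ℓ ≤ m)
    (A : Matrix (Fin m) (Fin n) ℝ)
    (Q : Matrix (Fin m) (Fin k) ℝ) (hQ : Qᵀ * Q = 1) :
    ∀ (i : Fin k) (j : Fin n),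
      ∫ Ψ, ((((Ψ * Q)ᵀ * (Ψ * Q))⁻¹ * (Ψ * Q)ᵀ * (Ψ * A) - Qᵀ * A) i j)
          ∂(gaussMatrix ℓ m) = 0 := by
  intro i j
  let R : Matrix (Fin m) (Fin m) ℝ := Q * Qᵀ + Q * Qᵀ - 1
  have hRQ : R * Q = Q := by
    simp [R, Matrix.sub_mul, Matrix.add_mul, Matrix.mul_assoc, hQ]
  have hRt : Rᵀ = R := by simp [R]
  have hRR : R * R = 1 := by
    have : R * R = R * Q * Qᵀ + R * Q * Qᵀ - R := by
      conv_lhs => rhs; unfold R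
      simp [Matrix.mul_sub, Matrix.mul_add, Matrix.mul_assoc]
    rw [this, hRQ]
    simp [R]
  have hinv : Function.Involutive fun Ψ : Matrix (Fin ℓ) (Fin m) ℝ => Ψ * R := fun Ψ => by
    simp [Matrix.mul_assoc, hRR]
  have hmp := measurePreserving_mul_gaussMatrix (t := ℓ) R (by rw [hRt, hRR])
  refine integral_eq_zero_of_ae_comp_eq_neg
    (MeasurableEquiv.ofInvolutive _ hinv hmp.measurable) hmp ?_
  filter_upwards [ae_isUnit_det_gram_s5 (by omega) Q Qᵀ hQ] with Ψ hΨ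
  change (((Ψ * R * Q)ᵀ * (Ψ * R * Q))⁻¹ * (Ψ * R * Q)ᵀ * (Ψ * R * A) - Qᵀ * A) i j = _
  rw [Matrix.mul_assoc Ψ R Q, hRQ, ← Matrix.neg_apply]
  refine congrFun (congrFun ?_ i) j
  have hid : ((Ψ * Q)ᵀ * (Ψ * Q))⁻¹ * (Ψ * Q)ᵀ * (Ψ * Q) = 1 := by
    rw [Matrix.mul_assoc, Matrix.nonsing_inv_mul _ hΨ]
  have hΨR : Ψ * R * A = Ψ * Q * (Qᵀ * A) + Ψ * Q * (Qᵀ * A) - Ψ * A := by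
    simp [R, Matrix.mul_sub, Matrix.sub_mul, Matrix.mul_add, Matrix.add_mul, Matrix.mul_assoc]
  rw [hΨR, Matrix.mul_sub, Matrix.mul_add, ← Matrix.mul_assoc _ (Ψ * Q), hid, Matrix.one_mul]
  abel
end
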